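/- arXiv:2305.04726 — 5 statements merged into one kernel-verified Lean document; each statement's English description precedes it below -/
import Mathlib

section
/- Let k ≥ 1 and γ > 0, and let (l_j) be a sequence as in the Cantor-type construction which additionally satisfies l_j − 2·l_{j+1} < l_{j−1} − 2·l_j for every j ≥ 1 and c₁·exp(−2^{j/γ}) ≤ l_j ≤ c₂·exp(−2^{j/γ}) for every j ≥ 1, for some constants 0 < c₁ ≤ c₂ (the 'meager' Cantor set 𝔠_{0,γ}). Then there exist C > 0 and t₀ ∈ (0,1/2) such that for every t ∈ (0,t₀), the k-dimensional Lebesgue measure of {x ∈ ℝ^k : dist(x, 𝔠^k) < t} (Euclidean distance) is at most C·t^k·(log(1/t))^{γk}. -/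
open MeasureTheory Real

noncomputable section

/-- Left endpoint of the generation-`m` interval of the Cantor-type construction
selected by the sequence of bits `σ` (bit `i` chooses the right child at step `i`). -/
def cantorLeft (l : ℕ → ℝ) (m : ℕ) (σ : ℕ → Bool) : ℝ :=
  -(1 / 2) + ∑ i ∈ Finset.range m, (if σ i then l i - l (i + 1) else 0)

/-- The generation-`m` pre-Cantor set: the union of the `2^m` generation-`m` intervals. -/
def preCantor (l : ℕ → ℝ) (m : ℕ) : Set ℝ :=
  ⋃ σ : ℕ → Bool, Set.Icc (cantorLeft l m σ) (cantorLeft l m σ + l m)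

/-- The Cantor set associated with the sequence of lengths `l`. -/
def cantorSetL (l : ℕ → ℝ) : Set ℝ := ⋂ m, preCantor l m

/-- The `k`-fold Cartesian power `𝔠^k ⊆ ℝ^k` of the Cantor set. -/
def cantorCube (l : ℕ → ℝ) (k : ℕ) : Set (EuclideanSpace ℝ (Fin k)) :=
  {x | ∀ i, x i ∈ cantorSetL l}

/-- A generation-`m` left endpoint depends only on the set of steps at which the
right child is selected. -/
lemma cantorLeft_eq_sum_filter (l : ℕ → ℝ) (m : ℕ) (σ : ℕ → Bool) :
    cantorLeft l m σ = -(1 / 2) + ∑ i ∈ Finset.range m with σ i, (l i - l (i + 1)) := by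
  rw [cantorLeft, Finset.sum_filter]

lemma neg_half_mem_cantorSetL {l : ℕ → ℝ} (hl : ∀ j, 0 ≤ l j) : -(1 / 2) ∈ cantorSetL l := by
  refine Set.mem_iInter.2 fun m => Set.mem_iUnion.2 ⟨fun _ => false, ?_⟩
  simpa [cantorLeft] using hl m

lemma cantorCube_nonempty {l : ℕ → ℝ} (hl : ∀ j, 0 ≤ l j) (k : ℕ) : (cantorCube l k).Nonempty :=
  ⟨WithLp.toLp 2 fun _ => -(1 / 2), fun _ => neg_half_mem_cantorSetL hl⟩

lemma volume_thickening_preCantor_le {l : ℕ → ℝ} {n : ℕ} {t : ℝ} (hn : l n ≤ t) :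
    volume (Metric.thickening t (preCantor l n)) ≤ ENNReal.ofReal (2 ^ n * (3 * t)) := by
  set A : Finset ℕ → ℝ := fun s => -(1 / 2) + ∑ i ∈ s, (l i - l (i + 1))
  have hsub : Metric.thickening t (preCantor l n) ⊆
      ⋃ s ∈ (Finset.range n).powerset, Set.Icc (A s - t) (A s + 2 * t) := by
    intro x hx
    obtain ⟨y, hy, hxy⟩ := Metric.mem_thickening_iff.1 hx
    obtain ⟨σ, hσ⟩ := Set.mem_iUnion.1 hy
    rw [cantorLeft_eq_sum_filter, Set.mem_Icc] at hσ
    rw [Real.dist_eq, abs_lt] at hxy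
    refine Set.mem_biUnion (x := {i ∈ Finset.range n | σ i})
      (Finset.mem_coe.2 (Finset.mem_powerset.2 (Finset.filter_subset _ _))) ?_
    constructor <;> simp only [A] <;> linarith
  calc volume (Metric.thickening t (preCantor l n))
      ≤ ∑ s ∈ (Finset.range n).powerset, volume (Set.Icc (A s - t) (A s + 2 * t)) :=
        (measure_mono hsub).trans (measure_biUnion_finset_le _ _)
    _ = ∑ _s ∈ (Finset.range n).powerset, ENNReal.ofReal (3 * t) := by
        refine Finset.sum_congr rfl fun s _ => ?_
        rw [Real.volume_Icc]
        congr 1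
        ring
    _ = ENNReal.ofReal (2 ^ n * (3 * t)) := by
        rw [Finset.sum_const, Finset.card_powerset, Finset.card_range, nsmul_eq_mul,
          ENNReal.ofReal_mul (by positivity)]
        simp

lemma volume_euclidean_cube (k : ℕ) (S : Set ℝ) (hS : MeasurableSet S) :
    volume {x : EuclideanSpace ℝ (Fin k) | ∀ i, x i ∈ S} = volume S ^ k := by
  have h := (EuclideanSpace.volume_preserving_symm_measurableEquiv_toLp (Fin k)).measure_preimage
    (s := Set.univ.pi fun _ => S) (MeasurableSet.univ_pi fun _ => hS).nullMeasurableSet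
  rw [volume_pi_pi, Finset.prod_const, Finset.card_univ, Fintype.card_fin] at h
  rw [← h]
  congr 1
  ext x
  simp

lemma infDist_cantorCube_lt_subset {l : ℕ → ℝ} (hl : ∀ j, 0 ≤ l j) (k n : ℕ) (t : ℝ) :
    {x : EuclideanSpace ℝ (Fin k) | Metric.infDist x (cantorCube l k) < t} ⊆
      {x | ∀ i, x i ∈ Metric.thickening t (preCantor l n)} := by
  intro x hx i
  obtain ⟨y, hy, hxy⟩ := (Metric.infDist_lt_iff (cantorCube_nonempty hl k)).1 hx
  refine Metric.mem_thickening_iff.2 ⟨y i, Set.mem_iInter.1 (hy i) n, lt_of_le_of_lt ?_ hxy⟩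
  rw [dist_eq_norm, dist_eq_norm]
  exact PiLp.norm_apply_le (x - y) i

/-- A generation `n` with `exp (-2 ^ (n / γ)) ≤ exp (-u)` and `2 ^ n` comparable to `u ^ γ`. -/
lemma exists_generation {γ u : ℝ} (hγ : 0 < γ) (hu : 1 < u) :
    ∃ n : ℕ, 1 ≤ n ∧ u ≤ (2 : ℝ) ^ ((n : ℝ) / γ) ∧ (2 : ℝ) ^ n ≤ 2 * u ^ γ := by
  have hu0 : 0 < u := by linarith
  have hlog : 0 < γ * Real.logb 2 u := mul_pos hγ (Real.logb_pos (by norm_num) hu)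
  have hpow : (2 : ℝ) ^ (γ * Real.logb 2 u) = u ^ γ := by
    rw [mul_comm, Real.rpow_mul (by norm_num), Real.rpow_logb (by norm_num) (by norm_num) hu0]
  refine ⟨⌈γ * Real.logb 2 u⌉₊, Nat.ceil_pos.2 hlog, ?_, ?_⟩
  · rw [← Real.logb_le_iff_le_rpow (by norm_num) hu0, le_div_iff₀ hγ, mul_comm]
    exact Nat.le_ceil _
  · calc (2 : ℝ) ^ ⌈γ * Real.logb 2 u⌉₊ = (2 : ℝ) ^ (⌈γ * Real.logb 2 u⌉₊ : ℝ) :=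
          (Real.rpow_natCast _ _).symm
      _ ≤ (2 : ℝ) ^ (γ * Real.logb 2 u + 1) :=
          Real.rpow_le_rpow_of_exponent_le (by norm_num) (Nat.ceil_lt_add_one hlog.le).le
      _ = 2 * u ^ γ := by
          rw [Real.rpow_add (by norm_num), hpow, Real.rpow_one, mul_comm]

/-- Lemma on the measure of neighbourhoods of meager Cantor sets `𝔠^k_{0,γ}`
(with `l_j ≍ exp(-2^{j/γ})`): the Lebesgue measure of the `t`-neighbourhood of
`𝔠^k` is `≲ t^k (log(1/t))^{γk}`. -/
theorem statement10 (k : ℕ) (hk : 1 ≤ k) (γ : ℝ) (hγ : 0 < γ)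
    (l : ℕ → ℝ) (hl0 : l 0 = 1) (hlpos : ∀ j, 0 < l j) (hl2 : ∀ j, 2 * l (j + 1) < l j)
    (hgap : ∀ j : ℕ, 1 ≤ j → l j - 2 * l (j + 1) < l (j - 1) - 2 * l j)
    (c₁ c₂ : ℝ) (hc₁ : 0 < c₁) (hc₁₂ : c₁ ≤ c₂)
    (hlow : ∀ j : ℕ, 1 ≤ j → c₁ * Real.exp (-(2 : ℝ) ^ ((j : ℝ) / γ)) ≤ l j)
    (hhigh : ∀ j : ℕ, 1 ≤ j → l j ≤ c₂ * Real.exp (-(2 : ℝ) ^ ((j : ℝ) / γ))) :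
    ∃ C : ℝ, 0 < C ∧ ∃ t₀ ∈ Set.Ioo (0 : ℝ) (1 / 2), ∀ t ∈ Set.Ioo (0 : ℝ) t₀,
      volume {x : EuclideanSpace ℝ (Fin k) | Metric.infDist x (cantorCube l k) < t}
        ≤ ENNReal.ofReal (C * t ^ (k : ℝ) * Real.log (1 / t) ^ (γ * k)) := by
  have hl : ∀ j, 0 ≤ l j := fun j => (hlpos j).le
  have hc₂ : 0 < c₂ := hc₁.trans_le hc₁₂
  refine ⟨(6 * 2 ^ γ) ^ k, by positivity, min (1 / 4) (1 / c₂),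
    ⟨by positivity, (min_le_left _ _).trans_lt (by norm_num)⟩, fun t ⟨ht0, ht⟩ => ?_⟩
  have ht4 : t < 1 / 4 := ht.trans_le (min_le_left _ _)
  have htc : c₂ * t ≤ 1 := by
    have := (lt_div_iff₀ hc₂).1 (ht.trans_le (min_le_right _ _))
    linarith
  have hL : 1 / 2 < Real.log (1 / t) := by
    have h2 : (2 : ℝ) ≤ 1 / t := by rw [le_div_iff₀ ht0]; linarith
    have := Real.log_le_log (by norm_num) h2
    linarith [Real.log_two_gt_d9]
  have hL0 : 0 < Real.log (1 / t) := by linarith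
  obtain ⟨n, hn1, hnu, hn2⟩ := exists_generation (u := 2 * Real.log (1 / t)) hγ (by linarith)
  have hexp : Real.exp (-(2 * Real.log (1 / t))) = t * t := by
    rw [one_div, Real.log_inv, mul_neg, neg_neg, two_mul, Real.exp_add, Real.exp_log ht0]
  have hln : l n ≤ t :=
    calc l n ≤ c₂ * Real.exp (-(2 : ℝ) ^ ((n : ℝ) / γ)) := hhigh n hn1
      _ ≤ c₂ * Real.exp (-(2 * Real.log (1 / t))) := by gcongr
      _ = c₂ * t * t := by rw [hexp, mul_assoc]
      _ ≤ t := mul_le_of_le_one_left ht0.le htc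
  rw [Real.mul_rpow (by norm_num) hL0.le] at hn2
  calc volume {x : EuclideanSpace ℝ (Fin k) | Metric.infDist x (cantorCube l k) < t}
      ≤ volume {x : EuclideanSpace ℝ (Fin k) |
          ∀ i, x i ∈ Metric.thickening t (preCantor l n)} :=
        measure_mono (infDist_cantorCube_lt_subset hl k n t)
    _ = volume (Metric.thickening t (preCantor l n)) ^ k :=
        volume_euclidean_cube k _ Metric.isOpen_thickening.measurableSet
    _ ≤ ENNReal.ofReal (2 ^ n * (3 * t)) ^ k := by
        gcongr
        exact volume_thickening_preCantor_le hln
    _ = ENNReal.ofReal ((2 ^ n * (3 * t)) ^ k) := (ENNReal.ofReal_pow (by positivity) k).symm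
    _ ≤ ENNReal.ofReal ((6 * 2 ^ γ) ^ k * t ^ (k : ℝ) * Real.log (1 / t) ^ (γ * k)) := by
        refine ENNReal.ofReal_le_ofReal ?_
        rw [Real.rpow_mul hL0.le, Real.rpow_natCast, Real.rpow_natCast, ← mul_pow, ← mul_pow]
        refine pow_le_pow_left₀ (by positivity) ?_ k
        calc (2 : ℝ) ^ n * (3 * t)
            ≤ 2 * (2 ^ γ * Real.log (1 / t) ^ γ) * (3 * t) := by gcongr
          _ = 6 * 2 ^ γ * t * Real.log (1 / t) ^ γ := by ring

end
end

section
/- Let k ≥ 1 and γ > 0, and let (l_j) be a sequence as in the Cantor-type construction which additionally satisfies l_j − 2·l_{j+1} < l_{j−1} − 2·l_j for every j ≥ 1 and c₁·exp(−2^{j/γ}) ≤ l_j ≤ c₂·exp(−2^{j/γ}) for every j ≥ 1, for some constants 0 < c₁ ≤ c₂. Let μ be a Borel probability measure on ℝ such that μ(I) = 2^{−m} for every generation-m interval I of the construction, and let μ^k be the k-fold product measure on ℝ^k. Then there exist C > 0 and t₀ ∈ (0,1/2) such that μ^k(B(x,t)) ≤ C·(log(1/t))^{−γk} for every x ∈ ℝ^k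 and every t ∈ (0,t₀), where B(x,t) denotes the open Euclidean ball of radius t. -/
open MeasureTheory Real
open scoped ENNReal

noncomputable section

/-- If two bit sequences first differ at `j < m`, the interval going right at `j` starts more than
`l m` to the right of the other one. -/
lemma cantorLeft_add_lt_of_first_diff {l : ℕ → ℝ} (hlpos : ∀ j, 0 < l j)
    (hl2 : ∀ j, 2 * l (j + 1) < l j) {σ τ : ℕ → Bool} {j m : ℕ} (hjm : j < m)
    (heq : ∀ i < j, σ i = τ i) (hσ : σ j = false) (hτ : τ j = true) :
    cantorLeft l m σ + l m < cantorLeft l m τ := by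
  induction m, Nat.succ_le_of_lt hjm using Nat.le_induction with
  | base =>
    have hsum : ∑ i ∈ Finset.range j, (if σ i then l i - l (i + 1) else 0)
        = ∑ i ∈ Finset.range j, (if τ i then l i - l (i + 1) else 0) :=
      Finset.sum_congr rfl fun i hi ↦ by rw [heq i (Finset.mem_range.1 hi)]
    simp only [cantorLeft, Nat.succ_eq_add_one, Finset.sum_range_succ, hsum, hσ, hτ]
    have := hl2 j
    simp only [Bool.false_eq_true, if_false, if_true]
    linarith
  | succ n hn ih =>
    have hlt := ih (Nat.lt_of_succ_le hn)
    simp only [cantorLeft, Finset.sum_range_succ] at hlt ⊢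
    have h1 := hl2 n
    have h2 := hlpos (n + 1)
    split_ifs <;> linarith

/-- Left endpoints of distinct generation-`m` intervals are more than `l m` apart. -/
lemma lt_abs_cantorLeft_sub {l : ℕ → ℝ} (hlpos : ∀ j, 0 < l j)
    (hl2 : ∀ j, 2 * l (j + 1) < l j) {σ τ : ℕ → Bool} {m : ℕ} (hne : ∃ i < m, σ i ≠ τ i) :
    l m < |cantorLeft l m σ - cantorLeft l m τ| := by
  classical
  obtain ⟨hjm, hj⟩ := Nat.find_spec hne
  have hmin : ∀ i < Nat.find hne, σ i = τ i := fun i hi ↦ by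
    by_contra h
    exact Nat.find_min hne hi ⟨hi.trans hjm, h⟩
  cases hσ : σ (Nat.find hne) <;> cases hτ : τ (Nat.find hne)
  · exact absurd (hσ.trans hτ.symm) hj
  · have := cantorLeft_add_lt_of_first_diff hlpos hl2 hjm hmin hσ hτ
    rw [abs_sub_comm]
    exact lt_of_lt_of_le (by linarith) (le_abs_self _)
  · have := cantorLeft_add_lt_of_first_diff hlpos hl2 hjm (fun i hi ↦ (hmin i hi).symm) hτ hσ
    exact lt_of_lt_of_le (by linarith) (le_abs_self _)
  · exact absurd (hσ.trans hτ.symm) hj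

/-- Extension of a finite word of bits by `false`. -/
def extendBits {m : ℕ} (f : Fin m → Bool) (i : ℕ) : Bool :=
  if h : i < m then f ⟨i, h⟩ else false

lemma exists_extendBits_ne {m : ℕ} {f g : Fin m → Bool} (h : f ≠ g) :
    ∃ i < m, extendBits f i ≠ extendBits g i := by
  obtain ⟨i, hi⟩ := Function.ne_iff.1 h
  exact ⟨i, i.2, by simpa [extendBits] using hi⟩

/-- An interval of length at most `l m` has Cantor measure at most `2 * 2 ^ (-m)`. -/
lemma measure_Ioo_le_of_le {l : ℕ → ℝ} (hlpos : ∀ j, 0 < l j)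
    (hl2 : ∀ j, 2 * l (j + 1) < l j) {μ : Measure ℝ} [IsProbabilityMeasure μ]
    (hμ : ∀ (m : ℕ) (σ : ℕ → Bool),
      μ (Set.Icc (cantorLeft l m σ) (cantorLeft l m σ + l m)) = ((2 : ℝ≥0∞) ^ m)⁻¹)
    {m : ℕ} {a b : ℝ} (hab : b - a ≤ l m) :
    μ (Set.Ioo a b) ≤ 2 * ((2 : ℝ≥0∞) ^ m)⁻¹ := by
  classical
  let I : (Fin m → Bool) → Set ℝ := fun f ↦
    Set.Icc (cantorLeft l m (extendBits f)) (cantorLeft l m (extendBits f) + l m)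
  have hsep : ∀ f g : Fin m → Bool, f ≠ g →
      l m < |cantorLeft l m (extendBits f) - cantorLeft l m (extendBits g)| := fun f g h ↦
    lt_abs_cantorLeft_sub hlpos hl2 (exists_extendBits_ne h)
  have hdisj : Pairwise (Function.onFun Disjoint I) := fun f g h ↦ by
    refine Set.disjoint_left.2 fun z hz hz' ↦ ?_
    rcases lt_abs.1 (hsep f g h) with h' | h' <;> linarith [hz.1, hz.2, hz'.1, hz'.2]
  have hmeas : ∀ f, MeasurableSet (I f) := fun f ↦ measurableSet_Icc
  have hU : μ (⋃ f, I f) = 1 := by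
    rw [measure_iUnion hdisj hmeas, tsum_fintype, Finset.sum_congr rfl fun f _ ↦ hμ m _]
    simp only [Finset.sum_const, Finset.card_univ, Fintype.card_fun, Fintype.card_bool,
      Fintype.card_fin, nsmul_eq_mul, Nat.cast_pow, Nat.cast_ofNat]
    exact ENNReal.mul_inv_cancel (by simp) (by simp)
  have hUc : μ (⋃ f, I f)ᶜ = 0 := by
    rw [measure_compl (MeasurableSet.iUnion hmeas) (measure_ne_top _ _), hU]
    simp
  let S : Finset (Fin m → Bool) := {f | (I f ∩ Set.Ioo a b).Nonempty}
  have hS : S.card ≤ 2 := by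
    by_contra! hcard
    obtain ⟨f, g, h, hf, hg, hh, hfg, hfh, hgh⟩ := Finset.two_lt_card_iff.1 hcard
    have hloc : ∀ f ∈ S, a - l m < cantorLeft l m (extendBits f) ∧
        cantorLeft l m (extendBits f) < b := fun f hf ↦ by
      obtain ⟨z, hz, hz'⟩ := (Finset.mem_filter.1 hf).2
      constructor <;> linarith [hz.1, hz.2, hz'.1, hz'.2]
    have hf' := hloc f hf
    have hg' := hloc g hg
    have hh' := hloc h hh
    rcases lt_abs.1 (hsep f g hfg) with h1 | h1 <;> rcases lt_abs.1 (hsep f h hfh) with h2 | h2 <;>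
      rcases lt_abs.1 (hsep g h hgh) with h3 | h3 <;>
      linarith [hf'.1, hf'.2, hg'.1, hg'.2, hh'.1, hh'.2]
  have hsub : Set.Ioo a b ⊆ (⋃ f, I f)ᶜ ∪ ⋃ f ∈ S, I f := fun z hz ↦ by
    by_cases hzU : z ∈ ⋃ f, I f
    · obtain ⟨f, hf⟩ := Set.mem_iUnion.1 hzU
      exact Or.inr (Set.mem_biUnion
        (show f ∈ S from Finset.mem_filter.2 ⟨Finset.mem_univ _, z, hf, hz⟩) hf)
    · exact Or.inl hzU
  calc μ (Set.Ioo a b) ≤ μ ((⋃ f, I f)ᶜ ∪ ⋃ f ∈ S, I f) := measure_mono hsub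
    _ ≤ μ (⋃ f, I f)ᶜ + μ (⋃ f ∈ S, I f) := measure_union_le _ _
    _ ≤ 0 + ∑ f ∈ S, μ (I f) := add_le_add hUc.le (measure_biUnion_finset_le _ _)
    _ = S.card * ((2 : ℝ≥0∞) ^ m)⁻¹ := by
      rw [zero_add, Finset.sum_congr rfl fun f _ ↦ hμ m _, Finset.sum_const, nsmul_eq_mul]
    _ ≤ 2 * ((2 : ℝ≥0∞) ^ m)⁻¹ := by gcongr; exact_mod_cast hS

/-- For small `t` there is a generation `m` whose intervals have length at least `2 * t`, while
`2 ^ (-m)` is controlled by a power of `log (1 / t)`. -/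
lemma exists_generation_s11 {γ : ℝ} (hγ : 0 < γ) {l : ℕ → ℝ} (hl0 : l 0 = 1) {c : ℝ} (hc : 0 < c)
    (hlow : ∀ j : ℕ, 1 ≤ j → c * Real.exp (-(2 : ℝ) ^ ((j : ℝ) / γ)) ≤ l j) {t : ℝ} (ht : 0 < t)
    (ht_half : t < 1 / 2) (ht_sq : t ≤ (c / 2) ^ 2) (ht_exp : t ≤ c / 2 * Real.exp (-1)) :
    ∃ m : ℕ, 2 * t ≤ l m ∧
      2 * ((2 : ℝ) ^ m)⁻¹ ≤ 4 * 2 ^ γ * Real.log (1 / t) ^ (-γ) := by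
  set L := Real.log (c / 2 / t) with hL
  have hL_exp : Real.exp L = c / 2 / t := Real.exp_log (by positivity)
  have hL1 : 1 ≤ L := by
    rw [hL, Real.le_log_iff_exp_le (by positivity), le_div_iff₀ ht]
    calc Real.exp 1 * t ≤ Real.exp 1 * (c / 2 * Real.exp (-1)) := by gcongr
      _ = c / 2 * (Real.exp 1 * Real.exp (-1)) := by ring
      _ = c / 2 := by rw [← Real.exp_add]; simp
  have hlog_pos : 0 < Real.log (1 / t) :=
    Real.log_pos (by rw [lt_div_iff₀ ht]; linarith)
  have hL_half : Real.log (1 / t) / 2 ≤ L := by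
    have h1 := Real.log_le_log ht ht_sq
    rw [Real.log_pow] at h1
    rw [hL, one_div, Real.log_inv, Real.log_div (by positivity) ht.ne']
    push_cast at h1
    linarith
  have hLpos : 0 < L := by linarith
  set m := ⌊γ * Real.logb 2 L⌋₊
  have hm_le : (m : ℝ) ≤ γ * Real.logb 2 L :=
    Nat.floor_le (mul_nonneg hγ.le (Real.logb_nonneg (by norm_num) hL1))
  have hm_lt : γ * Real.logb 2 L < m + 1 := Nat.lt_floor_add_one _
  have hlogb : (2 : ℝ) ^ Real.logb 2 L = L :=
    Real.rpow_logb (by norm_num) (by norm_num) hLpos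
  refine ⟨m, ?_, ?_⟩
  · rcases Nat.eq_zero_or_pos m with h0 | h0
    · rw [h0, hl0]; linarith
    · refine le_trans ?_ (hlow m h0)
      have hpow : (2 : ℝ) ^ ((m : ℝ) / γ) ≤ L := by
        rw [← hlogb]
        refine Real.rpow_le_rpow_of_exponent_le (by norm_num) ?_
        rw [div_le_iff₀ hγ]; linarith
      calc 2 * t = c * Real.exp (-L) := by rw [Real.exp_neg, hL_exp]; field_simp
        _ ≤ c * Real.exp (-(2 : ℝ) ^ ((m : ℝ) / γ)) := by gcongr
  · have hpow : L ^ γ ≤ 2 ^ m * 2 := by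
      calc L ^ γ = (2 : ℝ) ^ (γ * Real.logb 2 L) := by
            rw [mul_comm, Real.rpow_mul (by norm_num), hlogb]
        _ ≤ (2 : ℝ) ^ ((m + 1 : ℕ) : ℝ) :=
            Real.rpow_le_rpow_of_exponent_le (by norm_num) (by push_cast; exact hm_lt.le)
        _ = 2 ^ m * 2 := by rw [Real.rpow_natCast, pow_succ]
    have hhalf : Real.log (1 / t) ^ γ / 2 ^ γ ≤ L ^ γ := by
      rw [← Real.div_rpow hlog_pos.le (by norm_num)]
      exact Real.rpow_le_rpow (by positivity) hL_half hγ.le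
    have hle := (div_le_iff₀ (by positivity)).1 (hhalf.trans hpow)
    have := Real.rpow_pos_of_pos hlog_pos γ
    rw [Real.rpow_neg hlog_pos.le, ← div_eq_mul_inv, ← div_eq_mul_inv,
      div_le_div_iff₀ (by positivity) this]
    linarith

/-- Lemma on the Cantor measure of balls for meager Cantor sets
(with `l_j ≍ exp(-2^{j/γ})`): the `k`-fold product `μ^k` of the Cantor measure
satisfies `μ^k(B(x,t)) ≲ (log(1/t))^{-γk}`. -/
theorem statement11 (k : ℕ) (hk : 1 ≤ k) (γ : ℝ) (hγ : 0 < γ)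
    (l : ℕ → ℝ) (hl0 : l 0 = 1) (hlpos : ∀ j, 0 < l j) (hl2 : ∀ j, 2 * l (j + 1) < l j)
    (hgap : ∀ j : ℕ, 1 ≤ j → l j - 2 * l (j + 1) < l (j - 1) - 2 * l j)
    (c₁ c₂ : ℝ) (hc₁ : 0 < c₁) (hc₁₂ : c₁ ≤ c₂)
    (hlow : ∀ j : ℕ, 1 ≤ j → c₁ * Real.exp (-(2 : ℝ) ^ ((j : ℝ) / γ)) ≤ l j)
    (hhigh : ∀ j : ℕ, 1 ≤ j → l j ≤ c₂ * Real.exp (-(2 : ℝ) ^ ((j : ℝ) / γ)))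
    -- the Cantor measure: a Borel probability measure giving each generation-`m`
    -- interval the mass `2^{-m}`
    (μ : Measure ℝ) (hμprob : IsProbabilityMeasure μ)
    (hμ : ∀ (m : ℕ) (σ : ℕ → Bool),
      μ (Set.Icc (cantorLeft l m σ) (cantorLeft l m σ + l m)) = ((2 : ℝ≥0∞) ^ m)⁻¹)
    -- its `k`-fold product measure on `ℝ^k`
    (ν : Measure (EuclideanSpace ℝ (Fin k)))
    (hν : ∀ s : Fin k → Set ℝ, (∀ i, MeasurableSet (s i)) →
      ν {x | ∀ i, x i ∈ s i} = ∏ i, μ (s i)) :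
    ∃ C : ℝ, 0 < C ∧ ∃ t₀ ∈ Set.Ioo (0 : ℝ) (1 / 2),
      ∀ (x : EuclideanSpace ℝ (Fin k)), ∀ t ∈ Set.Ioo (0 : ℝ) t₀,
        ν (Metric.ball x t) ≤ ENNReal.ofReal (C * Real.log (1 / t) ^ (-(γ * k))) := by
  refine ⟨(4 * 2 ^ γ) ^ k, by positivity,
    min (1 / 4) (min ((c₁ / 2) ^ 2) (c₁ / 2 * Real.exp (-1))), ⟨by positivity, ?_⟩, ?_⟩
  · exact (min_le_left _ _).trans_lt (by norm_num)
  rintro x t ⟨ht, ht'⟩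
  obtain ⟨ht_quarter, ht_rest⟩ := lt_min_iff.1 ht'
  obtain ⟨ht_sq, ht_exp⟩ := lt_min_iff.1 ht_rest
  obtain ⟨m, htm, hm⟩ := exists_generation_s11 hγ hl0 hc₁ hlow ht (by linarith) ht_sq.le ht_exp.le
  have hlog : 0 ≤ Real.log (1 / t) :=
    Real.log_nonneg (by rw [le_div_iff₀ ht]; linarith)
  have hcoord : ∀ i, μ (Set.Ioo (x i - t) (x i + t)) ≤
      ENNReal.ofReal (4 * 2 ^ γ * Real.log (1 / t) ^ (-γ)) := fun i ↦ by
    refine (measure_Ioo_le_of_le hlpos hl2 hμ (m := m) (by linarith)).trans ?_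
    refine le_trans (le_of_eq ?_) (ENNReal.ofReal_le_ofReal hm)
    rw [ENNReal.ofReal_mul (by norm_num), ENNReal.ofReal_inv_of_pos (by positivity),
      ENNReal.ofReal_pow (by norm_num)]
    simp
  have hsub : Metric.ball x t ⊆ {z | ∀ i, z i ∈ Set.Ioo (x i - t) (x i + t)} := fun z hz i ↦ by
    have h1 : |z i - x i| < t := by
      have := PiLp.norm_apply_le (z - x) i
      rw [← dist_eq_norm] at this
      exact this.trans_lt (Metric.mem_ball.1 hz)
    rw [abs_lt] at h1
    constructor <;> linarith [h1.1, h1.2]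
  calc ν (Metric.ball x t)
      ≤ ∏ i, μ (Set.Ioo (x i - t) (x i + t)) :=
        (measure_mono hsub).trans_eq (hν _ fun i ↦ measurableSet_Ioo)
    _ ≤ ∏ _i : Fin k, ENNReal.ofReal (4 * 2 ^ γ * Real.log (1 / t) ^ (-γ)) :=
        Finset.prod_le_prod' fun i _ ↦ hcoord i
    _ = ENNReal.ofReal ((4 * 2 ^ γ) ^ k * Real.log (1 / t) ^ (-(γ * k))) := by
        rw [Finset.prod_const, Finset.card_univ, Fintype.card_fin,
          ← ENNReal.ofReal_pow (by positivity), mul_pow, ← neg_mul, Real.rpow_mul hlog,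
          Real.rpow_natCast]

end
end

section
/- Let (l_j) be a sequence as in the Cantor-type construction which additionally satisfies l_m − 2·l_{m+1} ≤ l_{m−1} − 2·l_m for every m ≥ 1 (decreasing gaps). Let j ≥ 1 and t > 0 with 2t < l_{j−1} − 2·l_j. Then: (i) every closed interval of length 2t in ℝ intersects at most one of the 2^j generation-j intervals; (ii) consequently, if μ is a Borel probability measure on ℝ with μ(I) = 2^{−m} for every generation-m interval I, then μ(J) ≤ 2^{−j} for every interval J ⊂ ℝ of length at most 2t. -/
open MeasureTheory Real
open scoped ENNReal

noncomputable section

theorem cantorLeft_succ (l : ℕ → ℝ) (m : ℕ) (σ : ℕ → Bool) :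
    cantorLeft l (m + 1) σ = cantorLeft l m σ + if σ m then l m - l (m + 1) else 0 := by
  simp only [cantorLeft, Finset.sum_range_succ]
  ring

theorem cantorLeft_update (l : ℕ → ℝ) (m : ℕ) (σ : ℕ → Bool) (b : Bool) :
    cantorLeft l m (Function.update σ m b) = cantorLeft l m σ := by
  unfold cantorLeft
  congr 1
  refine Finset.sum_congr rfl fun i hi => ?_
  rw [Function.update_of_ne (Finset.mem_range.mp hi).ne]

theorem cantorLeft_succ_update (l : ℕ → ℝ) (m : ℕ) (σ : ℕ → Bool) (b : Bool) :
    cantorLeft l (m + 1) (Function.update σ m b) =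
      cantorLeft l m σ + if b then l m - l (m + 1) else 0 := by
  rw [cantorLeft_succ, cantorLeft_update, Function.update_self]

/-- Two intervals of generation `m + 1` coincide or are separated by at least the gap
`l m - 2 * l (m + 1)`. -/
theorem cantorLeft_eq_or_separated (l : ℕ → ℝ) (hl2 : ∀ j, 2 * l (j + 1) < l j)
    (hlpos : ∀ j, 0 < l j)
    (hgap : ∀ m : ℕ, 1 ≤ m → l m - 2 * l (m + 1) ≤ l (m - 1) - 2 * l m)
    (m : ℕ) (σ τ : ℕ → Bool) :
    cantorLeft l (m + 1) σ = cantorLeft l (m + 1) τ ∨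
      cantorLeft l (m + 1) σ + (l m - l (m + 1)) ≤ cantorLeft l (m + 1) τ ∨
      cantorLeft l (m + 1) τ + (l m - l (m + 1)) ≤ cantorLeft l (m + 1) σ := by
  induction m with
  | zero =>
    simp only [cantorLeft, zero_add, Finset.sum_range_one]
    cases σ 0 <;> cases τ 0 <;> simp
  | succ m ih =>
    have hg := hgap (m + 1) (by omega)
    have h2 := hl2 (m + 1)
    have hp := hlpos (m + 1 + 1)
    simp only [Nat.add_sub_cancel] at hg
    rw [cantorLeft_succ l (m + 1) σ, cantorLeft_succ l (m + 1) τ]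
    rcases ih with h | h | h
    · rw [h]
      cases σ (m + 1) <;> cases τ (m + 1) <;> simp
    · right; left
      cases σ (m + 1) <;> cases τ (m + 1) <;> simp <;> linarith
    · right; right
      cases σ (m + 1) <;> cases τ (m + 1) <;> simp <;> linarith

theorem finite_range_cantorLeft (l : ℕ → ℝ) (m : ℕ) : (Set.range (cantorLeft l m)).Finite := by
  induction m with
  | zero =>
    refine (Set.finite_singleton (-(1 / 2) : ℝ)).subset ?_
    rintro _ ⟨σ, rfl⟩
    simp [cantorLeft]
  | succ m ih =>
    refine (ih.union (ih.image (· + (l m - l (m + 1))))).subset ?_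
    rintro _ ⟨σ, rfl⟩
    rw [cantorLeft_succ]
    cases σ m
    · left; simp
    · right; exact ⟨_, ⟨σ, rfl⟩, by simp⟩

/-- A measure giving each generation-`m` interval mass `2⁻ᵐ` is carried by the union of the
generation-`m` intervals. -/
theorem measure_compl_iUnion_cantor (l : ℕ → ℝ) (hlpos : ∀ j, 0 < l j)
    (hl2 : ∀ j, 2 * l (j + 1) < l j) (μ : Measure ℝ) [IsProbabilityMeasure μ]
    (hμ : ∀ (m : ℕ) (σ : ℕ → Bool),
      μ (Set.Icc (cantorLeft l m σ) (cantorLeft l m σ + l m)) = ((2 : ℝ≥0∞) ^ m)⁻¹) (m : ℕ) :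
    μ (⋃ σ, Set.Icc (cantorLeft l m σ) (cantorLeft l m σ + l m))ᶜ = 0 := by
  induction m with
  | zero =>
    have h := hμ 0 fun _ => false
    rw [pow_zero, inv_one, ← prob_compl_eq_zero_iff measurableSet_Icc] at h
    refine measure_mono_null (Set.compl_subset_compl.mpr ?_) h
    exact Set.subset_iUnion
      (fun σ => Set.Icc (cantorLeft l 0 σ) (cantorLeft l 0 σ + l 0)) fun _ => false
  | succ m ih =>
    have h2 := hl2 m
    have hp := hlpos (m + 1)
    have hnull : μ (⋃ a ∈ Set.range (cantorLeft l m), Set.Icc a (a + l m) \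
        (Set.Icc a (a + l (m + 1)) ∪ Set.Icc (a + (l m - l (m + 1))) (a + l m))) = 0 := by
      rw [measure_biUnion_null_iff (finite_range_cantorLeft l m).countable]
      rintro _ ⟨σ, rfl⟩
      have hleft := hμ (m + 1) (Function.update σ m false)
      have hright := hμ (m + 1) (Function.update σ m true)
      simp only [cantorLeft_succ_update, if_true, Bool.false_eq_true, if_false, add_zero]
        at hleft hright
      have he : cantorLeft l m σ + (l m - l (m + 1)) + l (m + 1) = cantorLeft l m σ + l m := by
        ring
      rw [he] at hright
      rw [measure_sdiff, measure_union _ measurableSet_Icc, hleft, hright, hμ m σ, pow_succ,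
        ENNReal.mul_inv (by simp) (by simp), ← mul_add, ENNReal.inv_two_add_inv_two, mul_one,
        tsub_self]
      · rw [Set.disjoint_left]
        rintro x ⟨_, hx⟩ ⟨hx', _⟩
        linarith
      · rintro x (⟨hx, hx'⟩ | ⟨hx, hx'⟩) <;> constructor <;> linarith
      · exact (measurableSet_Icc.union measurableSet_Icc).nullMeasurableSet
      · exact measure_ne_top _ _
    refine measure_mono_null ?_ (measure_union_null ih hnull)
    intro x hx
    by_contra hcon
    simp only [Set.mem_union, not_or, Set.mem_compl_iff, not_not] at hcon
    obtain ⟨hm, hd⟩ := hcon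
    obtain ⟨σ, hσ⟩ := Set.mem_iUnion.mp hm
    refine hd (Set.mem_biUnion (Set.mem_range_self σ) ⟨hσ, fun hch => hx ?_⟩)
    rw [Set.mem_iUnion]
    rcases hch with h | h
    · refine ⟨Function.update σ m false, ?_⟩
      simpa [cantorLeft_succ_update] using h
    · refine ⟨Function.update σ m true, ?_⟩
      rw [cantorLeft_succ_update]
      simp only [if_true]
      exact ⟨h.1, by linarith [h.2]⟩

/-- If the gaps of the Cantor-type construction are decreasing and `2t` is smaller
than the generation-`j` gap `l_{j-1} - 2 l_j`, then (i) a closed interval of length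
`2t` meets at most one generation-`j` interval, and (ii) the Cantor measure of any
interval of length at most `2t` is at most `2^{-j}`. -/
theorem statement13 (l : ℕ → ℝ) (hl0 : l 0 = 1) (hlpos : ∀ j, 0 < l j)
    (hl2 : ∀ j, 2 * l (j + 1) < l j)
    (hgap : ∀ m : ℕ, 1 ≤ m → l m - 2 * l (m + 1) ≤ l (m - 1) - 2 * l m)
    (j : ℕ) (hj : 1 ≤ j) (t : ℝ) (ht : 0 < t) (htj : 2 * t < l (j - 1) - 2 * l j) :
    (∀ c : ℝ, ∀ σ₁ σ₂ : ℕ → Bool,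
      (Set.Icc c (c + 2 * t) ∩
        Set.Icc (cantorLeft l j σ₁) (cantorLeft l j σ₁ + l j)).Nonempty →
      (Set.Icc c (c + 2 * t) ∩
        Set.Icc (cantorLeft l j σ₂) (cantorLeft l j σ₂ + l j)).Nonempty →
      Set.Icc (cantorLeft l j σ₁) (cantorLeft l j σ₁ + l j)
        = Set.Icc (cantorLeft l j σ₂) (cantorLeft l j σ₂ + l j)) ∧
    (∀ μ : Measure ℝ, IsProbabilityMeasure μ →
      (∀ (m : ℕ) (σ : ℕ → Bool),
        μ (Set.Icc (cantorLeft l m σ) (cantorLeft l m σ + l m)) = ((2 : ℝ≥0∞) ^ m)⁻¹) →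
      ∀ c d : ℝ, d - c ≤ 2 * t → μ (Set.Icc c d) ≤ ((2 : ℝ≥0∞) ^ j)⁻¹) := by
  have hsep : ∀ c : ℝ, ∀ σ₁ σ₂ : ℕ → Bool,
      (Set.Icc c (c + 2 * t) ∩
        Set.Icc (cantorLeft l j σ₁) (cantorLeft l j σ₁ + l j)).Nonempty →
      (Set.Icc c (c + 2 * t) ∩
        Set.Icc (cantorLeft l j σ₂) (cantorLeft l j σ₂ + l j)).Nonempty →
      Set.Icc (cantorLeft l j σ₁) (cantorLeft l j σ₁ + l j)
        = Set.Icc (cantorLeft l j σ₂) (cantorLeft l j σ₂ + l j) := by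
    obtain ⟨k, rfl⟩ := Nat.exists_eq_succ_of_ne_zero (Nat.one_le_iff_ne_zero.mp hj)
    simp only [Nat.succ_eq_add_one, Nat.add_sub_cancel] at htj ⊢
    rintro c σ τ ⟨x, ⟨hx1, hx2⟩, hx3, hx4⟩ ⟨y, ⟨hy1, hy2⟩, hy3, hy4⟩
    rcases cantorLeft_eq_or_separated l hl2 hlpos hgap k σ τ with h | h | h
    · rw [h]
    · linarith
    · linarith
  refine ⟨hsep, fun μ _ hμ c d hcd => ?_⟩
  have hsub : Set.Icc c d ⊆ Set.Icc c (c + 2 * t) := Set.Icc_subset_Icc_right (by linarith)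
  have hnull := measure_compl_iUnion_cantor l hlpos hl2 μ hμ j
  by_cases hmeet : ∃ σ, (Set.Icc c d ∩
      Set.Icc (cantorLeft l j σ) (cantorLeft l j σ + l j)).Nonempty
  · obtain ⟨σ, hσ⟩ := hmeet
    have hle := measure_union_le (μ := μ) (Set.Icc (cantorLeft l j σ) (cantorLeft l j σ + l j))
      (⋃ σ, Set.Icc (cantorLeft l j σ) (cantorLeft l j σ + l j))ᶜ
    rw [hnull, add_zero, hμ j σ] at hle
    refine le_trans (measure_mono fun x hx => ?_) hle
    by_cases hxU : x ∈ ⋃ σ, Set.Icc (cantorLeft l j σ) (cantorLeft l j σ + l j)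
    · obtain ⟨τ, hτ⟩ := Set.mem_iUnion.mp hxU
      left
      rw [hsep c σ τ (hσ.mono (Set.inter_subset_inter_left _ hsub)) ⟨x, hsub hx, hτ⟩]
      exact hτ
    · exact Or.inr hxU
  · have hzero : μ (Set.Icc c d) = 0 := by
      refine measure_mono_null (Set.subset_compl_iff_disjoint_right.mpr <|
        Set.disjoint_left.mpr fun x hx hxU => hmeet ?_) hnull
      obtain ⟨σ, hσ⟩ := Set.mem_iUnion.mp hxU
      exact ⟨σ, x, hx, hσ⟩
    rw [hzero]
    exact zero_le

end
end

section
/- Let N ≥ 2 and 1 ≤ k ≤ N−1. Let a₀ : [0,∞) → [0,∞) be nondecreasing and concave with a₀(0) = 0, let C ≥ 1, and let ρ : ℝ^N → [0,1] be a function that is differentiable at every point x with x̂ ≠ 0 and satisfies |∇ρ(x)| ≤ C/|x̂| at all such points. Define h(x) = a₀(|x̂|)·ρ(x) when x̂ ≠ 0 and h(x) = 0 when x̂ = 0, and define h′ in the same way with ρ replaced by 1 − ρ. Then there exists a constant C̃ > 1, depending only on C, such that |h(x) − h(y)| ≤ C̃·a₀(|x − y|) and |h′(x) − h′(y)| ≤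 C̃·a₀(|x − y|) for all x, y ∈ ℝ^N; that is, h and h′ have modulus of continuity C̃·a₀. -/
open MeasureTheory Real
open scoped Classical

noncomputable section

/-- `ℝ^N = ℝ^k × ℝ^{N-k}` with the Euclidean (`L²`) norm; a point `x` is written
`x = (x̄, x̂)` with `x̄ ∈ ℝ^k`, `x̂ ∈ ℝ^{N-k}`. -/
abbrev SplitEuc (N k : ℕ) :=
  WithLp 2 (EuclideanSpace ℝ (Fin k) × EuclideanSpace ℝ (Fin (N - k)))

/-- The component `x̂ ∈ ℝ^{N-k}` of `x = (x̄, x̂)`. -/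
def hatPart {N k : ℕ} (x : SplitEuc N k) : EuclideanSpace ℝ (Fin (N - k)) :=
  (WithLp.equiv 2 _ x).2

/-- A concave function on `[0,∞)` vanishing at `0` has nonincreasing slope from the origin. -/
theorem ConcaveOn.mul_le_mul_of_map_zero {a : ℝ → ℝ} (ha : ConcaveOn ℝ (Set.Ici 0) a)
    (h0 : a 0 = 0) {s t : ℝ} (hs : 0 ≤ s) (hst : s ≤ t) : s * a t ≤ t * a s := by
  rcases hs.eq_or_lt with rfl | hs'
  · simp [h0]
  have ht : 0 < t := hs'.trans_le hst
  have h := ha.2 (Set.mem_Ici.2 ht.le) (Set.mem_Ici.2 le_rfl) (div_nonneg hs ht.le)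
    (sub_nonneg.2 ((div_le_one ht).2 hst)) (add_sub_cancel _ _)
  simp only [smul_eq_mul, h0, mul_zero, add_zero, div_mul_cancel₀ s ht.ne'] at h
  rwa [div_mul_eq_mul_div, div_le_iff₀ ht, mul_comm (a s)] at h

/-- A concave function on `[0,∞)` vanishing at `0` is subadditive. -/
theorem ConcaveOn.map_add_le_of_map_zero {a : ℝ → ℝ} (ha : ConcaveOn ℝ (Set.Ici 0) a)
    (h0 : a 0 = 0) {s t : ℝ} (hs : 0 ≤ s) (ht : 0 ≤ t) : a (s + t) ≤ a s + a t := by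
  rcases (add_nonneg hs ht).eq_or_lt with h | h
  · obtain rfl : s = 0 := by linarith
    simp [h0]
  have h1 := ha.mul_le_mul_of_map_zero h0 hs (le_add_of_nonneg_right ht)
  have h2 := ha.mul_le_mul_of_map_zero h0 ht (le_add_of_nonneg_left hs)
  exact le_of_mul_le_mul_left (by linarith) h

/-- If `‖Dρ(x)‖ ≤ C / ‖p x‖` wherever `p x ≠ 0`, then the product `a(‖p x‖) ρ(x)` has modulus
of continuity `(2C + 1) a`, for `p` nonexpansive and `a` a concave modulus. -/
theorem abs_mul_sub_mul_le_of_norm_fderiv_le {E F : Type*} [NormedAddCommGroup E]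
    [NormedSpace ℝ E] [NormedAddCommGroup F] {p : E → F}
    (hp : ∀ x y, ‖p x - p y‖ ≤ ‖x - y‖) {C : ℝ} (hC : 1 ≤ C) {a : ℝ → ℝ}
    (hnonneg : ∀ s ∈ Set.Ici (0 : ℝ), 0 ≤ a s) (hmono : MonotoneOn a (Set.Ici 0))
    (hconc : ConcaveOn ℝ (Set.Ici 0) a) (h0 : a 0 = 0) {ρ : E → ℝ}
    (hρ : ∀ x, ρ x ∈ Set.Icc (0 : ℝ) 1)
    (hρ' : ∀ x, p x ≠ 0 → DifferentiableAt ℝ ρ x ∧ ‖fderiv ℝ ρ x‖ ≤ C / ‖p x‖) (x y : E) :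
    |a ‖p x‖ * ρ x - a ‖p y‖ * ρ y| ≤ (2 * C + 1) * a ‖x - y‖ := by
  wlog hxy : ‖p y‖ ≤ ‖p x‖ generalizing x y
  · rw [abs_sub_comm, norm_sub_rev]
    exact this y x (le_of_not_ge hxy)
  have hd : 0 ≤ ‖x - y‖ := norm_nonneg _
  have had := hnonneg _ hd
  have hax := hnonneg _ (norm_nonneg (p x))
  have hay := hnonneg _ (norm_nonneg (p y))
  have hayx : a ‖p y‖ ≤ a ‖p x‖ := hmono (norm_nonneg _) (norm_nonneg _) hxy
  obtain ⟨hx0, hx1⟩ := hρ x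
  obtain ⟨hy0, hy1⟩ := hρ y
  rcases le_or_gt ‖p x‖ (‖x - y‖ + ‖x - y‖) with hnear | hfar
  · have hax2 : a ‖p x‖ ≤ 2 * a ‖x - y‖ :=
      calc a ‖p x‖ ≤ a (‖x - y‖ + ‖x - y‖) :=
            hmono (norm_nonneg _) (add_nonneg hd hd) hnear
        _ ≤ a ‖x - y‖ + a ‖x - y‖ := hconc.map_add_le_of_map_zero h0 hd hd
        _ = 2 * a ‖x - y‖ := by ring
    calc |a ‖p x‖ * ρ x - a ‖p y‖ * ρ y| ≤ a ‖p x‖ :=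
          abs_sub_le_of_nonneg_of_le (mul_nonneg hax hx0) (mul_le_of_le_one_right hax hx1)
            (mul_nonneg hay hy0) ((mul_le_of_le_one_right hay hy1).trans hayx)
      _ ≤ 2 * a ‖x - y‖ := hax2
      _ ≤ (2 * C + 1) * a ‖x - y‖ := by gcongr; linarith
  · have hpx : 0 < ‖p x‖ := by linarith
    have hball : ∀ z ∈ Metric.closedBall x ‖x - y‖, ‖p x‖ / 2 ≤ ‖p z‖ := fun z hz => by
      have h1 := norm_sub_norm_le (p x) (p z)
      have h2 := hp x z
      rw [mem_closedBall_iff_norm'] at hz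
      linarith
    have hne : ∀ z ∈ Metric.closedBall x ‖x - y‖, p z ≠ 0 := fun z hz =>
      norm_pos_iff.1 ((half_pos hpx).trans_le (hball z hz))
    have hlip : |ρ x - ρ y| ≤ C / (‖p x‖ / 2) * ‖x - y‖ :=
      (convex_closedBall x ‖x - y‖).norm_image_sub_le_of_norm_fderiv_le
        (fun z hz => (hρ' z (hne z hz)).1)
        (fun z hz => (hρ' z (hne z hz)).2.trans
          (div_le_div_of_nonneg_left (by linarith) (half_pos hpx) (hball z hz)))
        (by rw [mem_closedBall_iff_norm']) (Metric.mem_closedBall_self hd)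
    have hslope : ‖x - y‖ * a ‖p x‖ ≤ ‖p x‖ * a ‖x - y‖ :=
      hconc.mul_le_mul_of_map_zero h0 hd (by linarith)
    have hincr : a ‖p x‖ - a ‖p y‖ ≤ a ‖x - y‖ := by
      have h1 := hconc.map_add_le_of_map_zero h0 (norm_nonneg (p y)) (sub_nonneg.2 hxy)
      rw [add_sub_cancel] at h1
      have h2 : a (‖p x‖ - ‖p y‖) ≤ a ‖x - y‖ :=
        hmono (sub_nonneg.2 hxy) hd ((norm_sub_norm_le _ _).trans (hp x y))
      linarith
    have hfirst : |a ‖p x‖ * (ρ x - ρ y)| ≤ 2 * C * a ‖x - y‖ := by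
      rw [abs_mul, abs_of_nonneg hax]
      calc a ‖p x‖ * |ρ x - ρ y| ≤ a ‖p x‖ * (C / (‖p x‖ / 2) * ‖x - y‖) := by gcongr
        _ = 2 * C * (‖x - y‖ * a ‖p x‖) / ‖p x‖ := by field_simp
        _ ≤ 2 * C * (‖p x‖ * a ‖x - y‖) / ‖p x‖ := by gcongr
        _ = 2 * C * a ‖x - y‖ := by field_simp
    have hsecond : |(a ‖p x‖ - a ‖p y‖) * ρ y| ≤ a ‖x - y‖ := by
      rw [abs_of_nonneg (mul_nonneg (sub_nonneg.2 hayx) hy0)]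
      exact (mul_le_of_le_one_right (sub_nonneg.2 hayx) hy1).trans hincr
    calc |a ‖p x‖ * ρ x - a ‖p y‖ * ρ y|
        = |a ‖p x‖ * (ρ x - ρ y) + (a ‖p x‖ - a ‖p y‖) * ρ y| := by ring_nf
      _ ≤ |a ‖p x‖ * (ρ x - ρ y)| + |(a ‖p x‖ - a ‖p y‖) * ρ y| := abs_add_le _ _
      _ ≤ (2 * C + 1) * a ‖x - y‖ := by linarith

/-- The projection `x ↦ x̂` is nonexpansive. -/
theorem norm_hatPart_sub_le {N k : ℕ} (x y : SplitEuc N k) :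
    ‖hatPart x - hatPart y‖ ≤ ‖x - y‖ :=
  WithLp.norm_snd_le _ (x - y)

/-- If `a₀` is nondecreasing and concave with `a₀(0) = 0`, `ρ : ℝ^N → [0,1]` is
differentiable with `|∇ρ(x)| ≤ C/|x̂|` wherever `x̂ ≠ 0`, then `a₀(|x̂|)ρ(x)` and
`a₀(|x̂|)(1-ρ(x))` have modulus of continuity `C̃ a₀` for some `C̃ > 1` depending
only on `C`. -/
theorem statement14 (C : ℝ) (hC : 1 ≤ C) :
    ∃ Ct : ℝ, 1 < Ct ∧
    ∀ (N k : ℕ), 2 ≤ N → 1 ≤ k → k ≤ N - 1 →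
    ∀ a₀ : ℝ → ℝ,
      (∀ s ∈ Set.Ici (0 : ℝ), 0 ≤ a₀ s) → MonotoneOn a₀ (Set.Ici 0) →
      ConcaveOn ℝ (Set.Ici 0) a₀ → a₀ 0 = 0 →
    ∀ ρ : SplitEuc N k → ℝ,
      (∀ x, ρ x ∈ Set.Icc (0 : ℝ) 1) →
      (∀ x : SplitEuc N k, hatPart x ≠ 0 →
        DifferentiableAt ℝ ρ x ∧ ‖gradient ρ x‖ ≤ C / ‖hatPart x‖) →
      (∀ x y : SplitEuc N k,
        |(if hatPart x = 0 then 0 else a₀ ‖hatPart x‖ * ρ x)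
          - (if hatPart y = 0 then 0 else a₀ ‖hatPart y‖ * ρ y)|
          ≤ Ct * a₀ ‖x - y‖) ∧
      (∀ x y : SplitEuc N k,
        |(if hatPart x = 0 then 0 else a₀ ‖hatPart x‖ * (1 - ρ x))
          - (if hatPart y = 0 then 0 else a₀ ‖hatPart y‖ * (1 - ρ y))|
          ≤ Ct * a₀ ‖x - y‖) := by
  refine ⟨2 * C + 1, by linarith, fun N k _ _ _ a₀ hnonneg hmono hconc h0 ρ hρ hρ' => ?_⟩
  have hite : ∀ (f : SplitEuc N k → ℝ) (x : SplitEuc N k),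
      (if hatPart x = 0 then 0 else a₀ ‖hatPart x‖ * f x) = a₀ ‖hatPart x‖ * f x := by
    intro f x
    split_ifs with h <;> simp [h, h0]
  have hfderiv : ∀ x : SplitEuc N k, hatPart x ≠ 0 →
      DifferentiableAt ℝ ρ x ∧ ‖fderiv ℝ ρ x‖ ≤ C / ‖hatPart x‖ := fun x hx =>
    ⟨(hρ' x hx).1, by simpa [gradient] using (hρ' x hx).2⟩
  refine ⟨fun x y => ?_, fun x y => ?_⟩
  · rw [hite ρ, hite ρ]
    exact abs_mul_sub_mul_le_of_norm_fderiv_le norm_hatPart_sub_le hC hnonneg hmono hconc h0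
      hρ hfderiv x y
  · rw [hite fun z => 1 - ρ z, hite fun z => 1 - ρ z]
    refine abs_mul_sub_mul_le_of_norm_fderiv_le (ρ := fun z => 1 - ρ z) norm_hatPart_sub_le hC
      hnonneg hmono hconc h0 (fun z => ?_) (fun z hz => ⟨?_, ?_⟩) x y
    · exact ⟨sub_nonneg.2 (hρ z).2, sub_le_self _ (hρ z).1⟩
    · exact (hfderiv z hz).1.const_sub 1
    · simpa only [fderiv_const_sub, norm_neg] using (hfderiv z hz).2

end
end

section
/- Let l ≥ 2 and let σ_l = 2π^{l/2}/Γ(l/2) be the (l−1)-dimensional surface measure of the unit sphere in ℝ^l. Define F : ℝ^l∖{0} → ℝ^l by F(x) = x/(σ_l·|x|^l). Then for every ε > 0 the outward flux of F through the boundary of the cube [−ε,ε]^l equals 1; explicitly, ∑_{j=1}^{l} ∫_{[−ε,ε]^{l−1}} ( F_j(ι_j^{+ε}(y)) − F_j(ι_j^{−ε}(y)) ) dy = 1, where for y ∈ ℝ^{l−1} and c ∈ ℝ, ι_j^{c}(y) ∈ ℝ^l denotes the point obtained from y by inserting c as the j-th coordinate. -/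
open MeasureTheory Real

noncomputable section

/-- The surface area of the unit sphere in `ℝ^l`, `σ_l = 2 π^{l/2} / Γ(l/2)`. -/
def sphereArea (l : ℕ) : ℝ := 2 * Real.pi ^ ((l : ℝ) / 2) / Real.Gamma ((l : ℝ) / 2)

/-- The gradient of the fundamental solution of the Laplace equation,
`F(x) = x / (σ_l |x|^l)`, written in coordinates on `ℝ^l` with the Euclidean
norm `|x| = √(∑ x_i²)`. -/
def fundGrad (l : ℕ) (x : Fin l → ℝ) (j : Fin l) : ℝ :=
  x j / (sphereArea l * Real.sqrt (∑ i, x i ^ 2) ^ l)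

/-- The Gaussian representation of the power `s^{-(m+1)/2}`. -/
theorem integral_pow_mul_exp_neg_mul_sq (m : ℕ) {s : ℝ} (hs : 0 < s) :
    ∫ t in Set.Ioi (0 : ℝ), t ^ m * Real.exp (-s * t ^ 2) =
      Real.Gamma (((m + 1 : ℕ) : ℝ) / 2) / 2 / Real.sqrt s ^ (m + 1) := by
  have h := integral_rpow_mul_exp_neg_mul_rpow (p := 2) (q := m) (b := s) two_pos
    (by have : (0 : ℝ) ≤ m := m.cast_nonneg
        linarith) hs
  simp only [rpow_natCast, rpow_two] at h
  have hpow : s ^ (-((m : ℝ) + 1) / 2) = (Real.sqrt s ^ (m + 1))⁻¹ := by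
    rw [Real.sqrt_eq_rpow, ← rpow_natCast, ← rpow_mul hs.le, ← rpow_neg hs.le]
    push_cast
    ring_nf
  rw [h, hpow]
  push_cast
  ring

theorem hasDerivAt_integral_exp_neg_sq (ε t : ℝ) :
    HasDerivAt (fun t : ℝ => ∫ u in (-(t * ε))..(t * ε), Real.exp (-u ^ 2))
      (2 * ε * Real.exp (-(t * ε) ^ 2)) t := by
  have hc : Continuous fun u : ℝ => Real.exp (-u ^ 2) := by fun_prop
  have hG (v : ℝ) : HasDerivAt (fun v : ℝ => ∫ u in (0 : ℝ)..v, Real.exp (-u ^ 2))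
      (Real.exp (-v ^ 2)) v := (hc.integral_hasStrictDerivAt 0 v).hasDerivAt
  have hlin : HasDerivAt (fun t : ℝ => t * ε) ε t := by
    simpa using (hasDerivAt_id t).mul_const ε
  have h := ((hG (t * ε)).comp t hlin).sub ((hG (-(t * ε))).comp t hlin.neg)
  refine (h.congr_deriv ?_).congr_of_eventuallyEq (.of_forall fun t => ?_)
  · rw [neg_sq]
    ring
  · exact (intervalIntegral.integral_interval_sub_left
      (hc.intervalIntegrable _ _) (hc.intervalIntegrable _ _)).symm

theorem tendsto_integral_exp_neg_sq {ε : ℝ} (hε : 0 < ε) :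
    Filter.Tendsto (fun t : ℝ => ∫ u in (-(t * ε))..(t * ε), Real.exp (-u ^ 2))
      Filter.atTop (nhds (Real.sqrt Real.pi)) := by
  have hint : Integrable fun u : ℝ => Real.exp (-u ^ 2) := by
    simpa using integrable_exp_neg_mul_sq (b := 1) one_pos
  have hval : ∫ u : ℝ, Real.exp (-u ^ 2) = Real.sqrt Real.pi := by
    simpa using integral_gaussian 1
  have ht : Filter.Tendsto (fun t : ℝ => t * ε) Filter.atTop Filter.atTop :=
    Filter.tendsto_id.atTop_mul_const hε
  rw [← hval]
  exact intervalIntegral_tendsto_integral hint (Filter.tendsto_neg_atTop_atBot.comp ht) ht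

theorem integral_deriv_pow_integral_exp_neg_sq (m : ℕ) {ε : ℝ} (hε : 0 < ε) :
    ∫ t in Set.Ioi (0 : ℝ), ((m : ℝ) + 1) *
        (∫ u in (-(t * ε))..(t * ε), Real.exp (-u ^ 2)) ^ m *
          (2 * ε * Real.exp (-(t * ε) ^ 2)) = Real.sqrt Real.pi ^ (m + 1) := by
  have h := integral_Ioi_of_hasDerivAt_of_nonneg' (a := 0)
    (fun t _ => (hasDerivAt_integral_exp_neg_sq ε t).pow (m + 1))
    (fun t (ht : 0 < t) => by
      have : 0 ≤ ∫ u in (-(t * ε))..(t * ε), Real.exp (-u ^ 2) :=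
        intervalIntegral.integral_nonneg (by nlinarith [mul_pos ht hε]) fun u _ => by positivity
      positivity)
    ((tendsto_integral_exp_neg_sq hε).pow (m + 1))
  simpa using h

theorem integral_cube_exp_neg_mul_sum_sq (m : ℕ) {ε t : ℝ} (hε : 0 < ε) :
    t ^ m * ∫ y in Set.univ.pi (fun _ : Fin m => Set.Icc (-ε) ε),
        Real.exp (-(ε ^ 2 + ∑ i, y i ^ 2) * t ^ 2) =
      (∫ u in (-(t * ε))..(t * ε), Real.exp (-u ^ 2)) ^ m * Real.exp (-(t * ε) ^ 2) := by
  have hexp (y : Fin m → ℝ) : Real.exp (-(ε ^ 2 + ∑ i, y i ^ 2) * t ^ 2) =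
      Real.exp (-(t * ε) ^ 2) * ∏ i, Real.exp (-(t * y i) ^ 2) := by
    rw [← Real.exp_sum, ← Real.exp_add, Finset.sum_neg_distrib]
    simp_rw [mul_pow]
    rw [← Finset.mul_sum]
    ring_nf
  have hone : t * ∫ x in Set.Icc (-ε) ε, Real.exp (-(t * x) ^ 2) =
      ∫ u in (-(t * ε))..(t * ε), Real.exp (-u ^ 2) := by
    rw [integral_Icc_eq_integral_Ioc, ← intervalIntegral.integral_of_le (by linarith),
      intervalIntegral.mul_integral_comp_mul_left (f := fun u => Real.exp (-u ^ 2)), mul_neg]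
  simp_rw [hexp]
  rw [integral_const_mul, volume_pi, Measure.restrict_pi_pi,
    integral_fintype_prod_eq_pow fun x => Real.exp (-(t * x) ^ 2), ← hone, mul_pow,
    Fintype.card_fin]
  ring

/-- The integral of `|x|^{-(m+1)}` over one face of the cube, in terms of Gaussian integrals. -/
theorem integral_face_eq (m : ℕ) {ε : ℝ} (hε : 0 < ε) :
    Real.Gamma (((m + 1 : ℕ) : ℝ) / 2) / 2 *
        ∫ y in Set.univ.pi (fun _ : Fin m => Set.Icc (-ε) ε),
          (Real.sqrt (ε ^ 2 + ∑ i, y i ^ 2) ^ (m + 1))⁻¹ =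
      ∫ t in Set.Ioi (0 : ℝ), (∫ u in (-(t * ε))..(t * ε), Real.exp (-u ^ 2)) ^ m *
        Real.exp (-(t * ε) ^ 2) := by
  have hpos (y : Fin m → ℝ) : 0 < ε ^ 2 + ∑ i, y i ^ 2 := by positivity
  have hbound : IntegrableOn (fun t : ℝ => t ^ m * Real.exp (-ε ^ 2 * t ^ 2)) (Set.Ioi 0) := by
    simpa using integrableOn_rpow_mul_exp_neg_mul_sq (b := ε ^ 2) (s := m) (by positivity)
      (by have : (0 : ℝ) ≤ m := m.cast_nonneg
          linarith)
  have hfin : IsFiniteMeasure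
      (volume.restrict (Set.univ.pi fun _ : Fin m => Set.Icc (-ε) ε)) :=
    isFiniteMeasure_restrict.2 (isCompact_univ_pi fun _ => isCompact_Icc).measure_ne_top
  have hint : Integrable (Function.uncurry fun (y : Fin m → ℝ) (t : ℝ) =>
      t ^ m * Real.exp (-(ε ^ 2 + ∑ i, y i ^ 2) * t ^ 2))
      ((volume.restrict (Set.univ.pi fun _ : Fin m => Set.Icc (-ε) ε)).prod
        (volume.restrict (Set.Ioi 0))) := by
    refine ((integrable_const (1 : ℝ)).mul_prod hbound).mono
      (Continuous.aestronglyMeasurable (by fun_prop)) (.of_forall fun ⟨y, t⟩ => ?_)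
    have hy : 0 ≤ ∑ i, y i ^ 2 := by positivity
    simp only [Function.uncurry, one_mul, norm_mul, Real.norm_eq_abs, Real.abs_exp]
    gcongr
    linarith
  calc
    _ = ∫ y in Set.univ.pi (fun _ : Fin m => Set.Icc (-ε) ε), ∫ t in Set.Ioi (0 : ℝ),
          t ^ m * Real.exp (-(ε ^ 2 + ∑ i, y i ^ 2) * t ^ 2) := by
      simp_rw [integral_pow_mul_exp_neg_mul_sq m (hpos _), div_eq_mul_inv _ (Real.sqrt _ ^ _)]
      rw [integral_const_mul]
    _ = _ := by
      rw [integral_integral_swap hint]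
      simp only [integral_const_mul, integral_cube_exp_neg_mul_sum_sq m hε]

theorem fundGrad_face_sub (m : ℕ) (ε : ℝ) (j : Fin (m + 1)) (y : Fin m → ℝ) :
    fundGrad (m + 1) (j.insertNth ε y) j - fundGrad (m + 1) (j.insertNth (-ε) y) j =
      2 * ε / sphereArea (m + 1) * (Real.sqrt (ε ^ 2 + ∑ i, y i ^ 2) ^ (m + 1))⁻¹ := by
  simp only [fundGrad, Fin.sum_univ_succAbove _ j, Fin.insertNth_apply_same,
    Fin.insertNth_apply_succAbove, neg_sq, div_eq_mul_inv, mul_inv]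
  ring

/-- The flux of `F(x) = x/(σ_l |x|^l)` through the boundary of the cube `[-ε,ε]^l`
(`l = m + 1 ≥ 2`) equals `1`: summing over the pairs of opposite faces,
`∑_j ∫_{[-ε,ε]^{l-1}} (F_j(ι_j^{+ε}(y)) - F_j(ι_j^{-ε}(y))) dy = 1`, where
`ι_j^c(y)` inserts `c` as the `j`-th coordinate of `y ∈ ℝ^{l-1}`. -/
theorem statement15 (m : ℕ) (hm : 1 ≤ m) (ε : ℝ) (hε : 0 < ε) :
    ∑ j : Fin (m + 1),
      ∫ y in Set.univ.pi (fun _ : Fin m => Set.Icc (-ε) ε),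
        (fundGrad (m + 1) (j.insertNth ε y) j - fundGrad (m + 1) (j.insertNth (-ε) y) j)
      = 1 := by
  have hΓ : 0 < Real.Gamma (((m + 1 : ℕ) : ℝ) / 2) := Real.Gamma_pos_of_pos (by positivity)
  have hπ : Real.pi ^ (((m + 1 : ℕ) : ℝ) / 2) = Real.sqrt Real.pi ^ (m + 1) := by
    rw [Real.sqrt_eq_rpow, ← rpow_natCast, ← rpow_mul Real.pi_pos.le]
    ring_nf
  have htotal := integral_deriv_pow_integral_exp_neg_sq m hε
  have hcomm (t : ℝ) : ((m : ℝ) + 1) * (∫ u in (-(t * ε))..(t * ε), Real.exp (-u ^ 2)) ^ m *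
      (2 * ε * Real.exp (-(t * ε) ^ 2)) = ((m : ℝ) + 1) * (2 * ε) *
        ((∫ u in (-(t * ε))..(t * ε), Real.exp (-u ^ 2)) ^ m * Real.exp (-(t * ε) ^ 2)) := by
    ring
  simp_rw [hcomm] at htotal
  rw [integral_const_mul, ← integral_face_eq m hε] at htotal
  simp_rw [fundGrad_face_sub, integral_const_mul]
  rw [Finset.sum_const, Finset.card_univ, Fintype.card_fin, nsmul_eq_mul, sphereArea, hπ]
  have hne : Real.sqrt Real.pi ^ (m + 1) ≠ 0 := by positivity
  generalize Real.sqrt Real.pi ^ (m + 1) = P at *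
  generalize Real.Gamma (((m + 1 : ℕ) : ℝ) / 2) = G at *
  generalize ∫ y in Set.univ.pi (fun _ : Fin m => Set.Icc (-ε) ε),
    (Real.sqrt (ε ^ 2 + ∑ i, y i ^ 2) ^ (m + 1))⁻¹ = I at *
  field_simp
  push_cast
  linear_combination htotal


end
end
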